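/- arXiv:math/0211286 — 2 statements merged into one kernel-verified Lean document; each statement's English description precedes it below -/
import Mathlib

section
/- Let d ≥ 2 and let P_1, P_2 be convex polytopes in R^d. Suppose there is no unit vector n such that the face of P_1 with outward normal n can be translated to a proper subset of the face of P_2 with outward normal n, and no unit vector n such that the face of P_2 with outward normal n can be translated to a proper subset of the face of P_1 with outward normal n. Then P_2 is a translate of P_1. -/
open MeasureTheory

noncomputable section

/-- A convex polytope in `ℝ^d`: the convex hull of a finite set of points,
with nonempty interior. -/
def IsConvexPolytope {d : ℕ} (P : Set (EuclideanSpace ℝ (Fin d))) : Prop :=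
  (∃ S : Finset (EuclideanSpace ℝ (Fin d)), P = convexHull ℝ (S : Set (EuclideanSpace ℝ (Fin d)))) ∧
  (interior P).Nonempty

/-- The face of `P` with outward normal vector `n`: the set of maximizers of `⟪·, n⟫` on `P`. -/
def face {d : ℕ} (P : Set (EuclideanSpace ℝ (Fin d))) (n : EuclideanSpace ℝ (Fin d)) :
    Set (EuclideanSpace ℝ (Fin d)) :=
  {x | x ∈ P ∧ ∀ y ∈ P, inner (𝕜 := ℝ) y n ≤ inner (𝕜 := ℝ) x n}

/-- The dimension of a face: the dimension of its affine hull. -/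
def faceDim {d : ℕ} (F : Set (EuclideanSpace ℝ (Fin d))) : ℕ :=
  Module.finrank ℝ (affineSpan ℝ F).direction

/-- `A` can be put inside `B` by a translation: some translate of `A` is a subset of `B`
not coinciding with `B`. -/
def CanPutInside {d : ℕ} (A B : Set (EuclideanSpace ℝ (Fin d))) : Prop :=
  ∃ v : EuclideanSpace ℝ (Fin d), (fun x => v + x) '' A ⊂ B

/-- `Q` is a translate of `P`. -/
def IsTranslate {d : ℕ} (P Q : Set (EuclideanSpace ℝ (Fin d))) : Prop :=
  ∃ v : EuclideanSpace ℝ (Fin d), Q = (fun x => v + x) '' P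

open scoped RealInnerProductSpace Topology

/-- The support function of the convex hull of a nonempty finite set. -/
def supportFn {d : ℕ} (S : Finset (EuclideanSpace ℝ (Fin d))) (hS : S.Nonempty)
    (n : EuclideanSpace ℝ (Fin d)) : ℝ :=
  S.sup' hS fun s => ⟪s, n⟫

section SupportFn

variable {d : ℕ} {S : Finset (EuclideanSpace ℝ (Fin d))} (hS : S.Nonempty)

lemma inner_le_of_mem_convexHull {A : Set (EuclideanSpace ℝ (Fin d))}
    {x n : EuclideanSpace ℝ (Fin d)} {r : ℝ} (hA : ∀ s ∈ A, ⟪s, n⟫ ≤ r)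
    (hx : x ∈ convexHull ℝ A) : ⟪x, n⟫ ≤ r := by
  have hconv : Convex ℝ {y : EuclideanSpace ℝ (Fin d) | ⟪y, n⟫ ≤ r} :=
    convex_halfSpace_le ⟨fun x y => inner_add_left x y n,
      fun c x => by simp [inner_smul_left]⟩ r
  exact convexHull_min hA hconv hx

lemma inner_le_supportFn {x : EuclideanSpace ℝ (Fin d)} (hx : x ∈ convexHull ℝ (S : Set _))
    (n : EuclideanSpace ℝ (Fin d)) : ⟪x, n⟫ ≤ supportFn S hS n :=
  inner_le_of_mem_convexHull
    (fun _ hs => Finset.le_sup' (fun s => ⟪s, n⟫) (Finset.mem_coe.1 hs)) hx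

lemma exists_inner_eq_supportFn (n : EuclideanSpace ℝ (Fin d)) :
    ∃ s ∈ S, supportFn S hS n = ⟪s, n⟫ :=
  Finset.exists_mem_eq_sup' hS _

lemma continuous_supportFn : Continuous (supportFn S hS) :=
  Continuous.finset_sup'_apply hS fun _ _ => by fun_prop

lemma supportFn_smul {r : ℝ} (hr : 0 ≤ r) (n : EuclideanSpace ℝ (Fin d)) :
    supportFn S hS (r • n) = r * supportFn S hS n := by
  apply le_antisymm
  · obtain ⟨s, hs, h⟩ := exists_inner_eq_supportFn hS (r • n)
    rw [h, inner_smul_right]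
    exact mul_le_mul_of_nonneg_left
      (inner_le_supportFn hS (subset_convexHull ℝ _ hs) n) hr
  · obtain ⟨s, hs, h⟩ := exists_inner_eq_supportFn hS n
    rw [h, ← inner_smul_right]
    exact inner_le_supportFn hS (subset_convexHull ℝ _ hs) _

lemma mem_face_convexHull_iff {x n : EuclideanSpace ℝ (Fin d)} :
    x ∈ face (convexHull ℝ (S : Set _)) n ↔
      x ∈ convexHull ℝ (S : Set _) ∧ ⟪x, n⟫ = supportFn S hS n := by
  refine and_congr_right fun hx => ⟨fun h => ?_, fun h y hy => ?_⟩
  · obtain ⟨s, hs, hs'⟩ := exists_inner_eq_supportFn hS n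
    exact le_antisymm (inner_le_supportFn hS hx n) (hs' ▸ h s (subset_convexHull ℝ _ hs))
  · exact (inner_le_supportFn hS hy n).trans h.ge

/-- A face of the convex hull of `S` is the convex hull of the points of `S` lying on it. -/
lemma face_convexHull (n : EuclideanSpace ℝ (Fin d)) :
    face (convexHull ℝ (S : Set _)) n =
      convexHull ℝ ((S.filter fun s => ⟪s, n⟫ = supportFn S hS n : Finset _) : Set _) := by
  ext x
  constructor
  · intro hx
    obtain ⟨hxS, hxn⟩ := (mem_face_convexHull_iff hS).1 hx
    obtain ⟨w, hw0, hw1, hwx⟩ := Finset.mem_convexHull'.1 hxS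
    have hle : ∀ s ∈ S, 0 ≤ w s * (supportFn S hS n - ⟪s, n⟫) := fun s hs =>
      mul_nonneg (hw0 s hs)
        (sub_nonneg.2 (inner_le_supportFn hS (subset_convexHull ℝ _ hs) n))
    have hsum : ∑ s ∈ S, w s * (supportFn S hS n - ⟪s, n⟫) = 0 := by
      have : ∑ s ∈ S, w s * ⟪s, n⟫ = supportFn S hS n := by
        rw [← hxn, ← hwx, sum_inner]
        simp [inner_smul_left]
      simp only [mul_sub, Finset.sum_sub_distrib, ← Finset.sum_mul, hw1, one_mul, this, sub_self]
    have hzero : ∀ s ∈ S, ¬ ⟪s, n⟫ = supportFn S hS n → w s = 0 := fun s hs hne =>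
      (mul_eq_zero.1 ((Finset.sum_eq_zero_iff_of_nonneg hle).1 hsum s hs)).resolve_right
        fun h => hne (sub_eq_zero.1 h).symm
    refine Finset.mem_convexHull'.2 ⟨w, fun s hs => hw0 s (Finset.mem_filter.1 hs).1, ?_, ?_⟩
    · rw [← hw1]
      refine Finset.sum_subset (Finset.filter_subset _ _) fun s hs hs' => ?_
      exact hzero s hs fun h => hs' (Finset.mem_filter.2 ⟨hs, h⟩)
    · rw [← hwx]
      refine Finset.sum_subset (Finset.filter_subset _ _) fun s hs hs' => ?_
      rw [hzero s hs fun h => hs' (Finset.mem_filter.2 ⟨hs, h⟩), zero_smul]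
  · intro hx
    refine (mem_face_convexHull_iff hS).2
      ⟨convexHull_mono (Finset.coe_subset.2 (Finset.filter_subset _ _)) hx, ?_⟩
    have hle : ⟪x, n⟫ ≤ supportFn S hS n :=
      inner_le_of_mem_convexHull (fun s hs => (Finset.mem_filter.1 (Finset.mem_coe.1 hs)).2.le) hx
    have hge : ⟪x, -n⟫ ≤ -supportFn S hS n :=
      inner_le_of_mem_convexHull (fun s hs => by
        rw [inner_neg_right, (Finset.mem_filter.1 (Finset.mem_coe.1 hs)).2]) hx
    rw [inner_neg_right] at hge
    linarith

/-- Near `n₀`, the support function is determined by the face with normal `n₀`. -/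
lemma eventually_exists_mem_face (n₀ : EuclideanSpace ℝ (Fin d)) :
    ∀ᶠ n in 𝓝 n₀, ∃ y ∈ face (convexHull ℝ (S : Set _)) n₀, supportFn S hS n = ⟪y, n⟫ := by
  obtain ⟨s₀, hs₀, h₀⟩ := exists_inner_eq_supportFn hS n₀
  have hev : ∀ᶠ n in 𝓝 n₀, ∀ s ∈ S, ⟪s, n₀⟫ < ⟪s₀, n₀⟫ → ⟪s, n⟫ < ⟪s₀, n⟫ := by
    rw [Filter.eventually_all_finset]
    intro s _
    by_cases h : ⟪s, n₀⟫ < ⟪s₀, n₀⟫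
    · have hc : ∀ v : EuclideanSpace ℝ (Fin d), Continuous fun n => ⟪v, n⟫ :=
        fun v => by fun_prop
      filter_upwards [(hc s).continuousAt.eventually_lt (hc s₀).continuousAt h] with n hn _
      exact hn
    · exact Filter.Eventually.of_forall fun n h' => absurd h' h
  filter_upwards [hev] with n hn
  obtain ⟨s, hs, h⟩ := exists_inner_eq_supportFn hS n
  refine ⟨s, (mem_face_convexHull_iff hS).2 ⟨subset_convexHull ℝ _ hs, ?_⟩, h⟩
  by_contra hne
  have hlt := lt_of_le_of_ne (inner_le_supportFn hS (subset_convexHull ℝ _ hs) n₀) hne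
  have := hn s hs (h₀ ▸ hlt)
  have := inner_le_supportFn hS (subset_convexHull ℝ _ hs₀) n
  linarith

end SupportFn

lemma face_smul {d : ℕ} (P : Set (EuclideanSpace ℝ (Fin d))) (n : EuclideanSpace ℝ (Fin d))
    {r : ℝ} (hr : 0 < r) : face P (r • n) = face P n := by
  ext x
  simp only [face, Set.mem_ofPred_eq, inner_smul_right, mul_le_mul_iff_right₀ hr]

/-- If two nonempty finite sets lie on parallel lines, then the convex hull of one of them can be
translated into the convex hull of the other. -/
lemma exists_translate_convexHull_subset {E : Type*} [AddCommGroup E] [Module ℝ E]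
    {A B : Finset E} (hA : A.Nonempty) (hB : B.Nonempty) (e : E)
    (hAe : ∀ a ∈ A, ∀ a' ∈ A, a - a' ∈ Submodule.span ℝ {e})
    (hBe : ∀ b ∈ B, ∀ b' ∈ B, b - b' ∈ Submodule.span ℝ {e}) :
    (∃ v : E, (fun x => v + x) '' convexHull ℝ (A : Set E) ⊆ convexHull ℝ (B : Set E)) ∨
      ∃ v : E, (fun x => v + x) '' convexHull ℝ (B : Set E) ⊆ convexHull ℝ (A : Set E) := by
  have hseg : ∀ C : Finset E, C.Nonempty →
      (∀ c ∈ C, ∀ c' ∈ C, c - c' ∈ Submodule.span ℝ {e}) →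
      ∃ (p : E) (a b : ℝ),
        convexHull ℝ (C : Set E) = (fun t : ℝ => p + t • e) '' Set.Icc a b := by
    intro C ⟨c₀, hc₀⟩ hC
    have hcoef : ∀ c, ∃ t : ℝ, c ∈ C → c = c₀ + t • e := by
      intro c
      by_cases hc : c ∈ C
      · obtain ⟨t, ht⟩ := Submodule.mem_span_singleton.1 (hC c hc c₀ hc₀)
        exact ⟨t, fun _ => by rw [ht]; abel⟩
      · exact ⟨0, fun h => absurd h hc⟩
    choose τ hτ using hcoef
    obtain ⟨m, hm, hmin⟩ := C.exists_min_image τ ⟨c₀, hc₀⟩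
    obtain ⟨M, hM, hmax⟩ := C.exists_max_image τ ⟨c₀, hc₀⟩
    have hf : ⇑(AffineMap.lineMap c₀ (c₀ + e) : ℝ →ᵃ[ℝ] E) = fun t => c₀ + t • e := by
      ext t
      simp [AffineMap.lineMap_apply, add_comm]
    have hCτ : (C : Set E) =
        (AffineMap.lineMap c₀ (c₀ + e) : ℝ →ᵃ[ℝ] E) '' (τ '' (C : Set E)) := by
      rw [hf, Set.image_image]
      exact ((Set.image_congr fun c hc => (hτ c hc).symm).trans (Set.image_id' _)).symm
    have hIcc : convexHull ℝ (τ '' (C : Set E)) = Set.Icc (τ m) (τ M) := by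
      apply Set.Subset.antisymm
      · refine convexHull_min ?_ (convex_Icc _ _)
        rintro _ ⟨c, hc, rfl⟩
        exact ⟨hmin c hc, hmax c hc⟩
      · rw [← segment_eq_Icc (hmin M hM)]
        exact segment_subset_convexHull ⟨m, hm, rfl⟩ ⟨M, hM, rfl⟩
    exact ⟨c₀, τ m, τ M, by rw [hCτ, ← AffineMap.image_convexHull, hIcc, hf]⟩
  have hfit : ∀ (p q : E) (a b a' b' : ℝ), b - a ≤ b' - a' →
      ∃ v : E, (fun x => v + x) '' ((fun t : ℝ => p + t • e) '' Set.Icc a b) ⊆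
        (fun t : ℝ => q + t • e) '' Set.Icc a' b' := by
    intro p q a b a' b' hle
    refine ⟨q - p + (a' - a) • e, ?_⟩
    rintro _ ⟨_, ⟨t, ht, rfl⟩, rfl⟩
    refine ⟨t + (a' - a), ⟨by linarith [ht.1], by linarith [ht.2]⟩, ?_⟩
    simp only [add_smul]
    abel
  obtain ⟨p, a, b, hp⟩ := hseg A hA hAe
  obtain ⟨q, a', b', hq⟩ := hseg B hB hBe
  rw [hp, hq]
  exact (le_total (b - a) (b' - a')).imp (hfit _ _ _ _ _ _) (hfit _ _ _ _ _ _)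

/-- A locally affine function on the line is affine. -/
lemma add_eq_two_mul_of_eventually_affine {g : ℝ → ℝ}
    (hg : ∀ t₀, ∃ a b : ℝ, ∀ᶠ t in 𝓝 t₀, g t = a + t * b) :
    g 0 + g 1 = 2 * g (1 / 2) := by
  have hderiv : ∀ t₀, ∃ b : ℝ, ∀ᶠ t in 𝓝 t₀, HasDerivAt g b t := by
    intro t₀
    obtain ⟨a, b, h⟩ := hg t₀
    refine ⟨b, ?_⟩
    filter_upwards [h.eventually_nhds] with t ht
    have : HasDerivAt (fun t : ℝ => a + t * b) b t := by
      simpa using ((hasDerivAt_id t).mul_const b).const_add a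
    exact this.congr_of_eventuallyEq ht
  have hloc : IsLocallyConstant (deriv g) := by
    rw [IsLocallyConstant.iff_eventually_eq]
    intro t₀
    obtain ⟨b, hb⟩ := hderiv t₀
    filter_upwards [hb] with t ht
    rw [ht.deriv, hb.self_of_nhds.deriv]
  have hdiff : Differentiable ℝ g := fun t =>
    let ⟨_, hb⟩ := hderiv t
    hb.self_of_nhds.differentiableAt
  have hsub : ∀ t, HasDerivAt (fun t => g t - t * deriv g 0) 0 t := by
    intro t
    have h := (hdiff t).hasDerivAt.sub ((hasDerivAt_id t).mul_const (deriv g 0))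
    rw [hloc.apply_eq_of_preconnectedSpace t 0, one_mul, sub_self] at h
    exact h
  have hconst := is_const_of_deriv_eq_zero (fun t => (hsub t).differentiableAt)
    fun t => (hsub t).deriv
  have h1 := hconst 0 1
  have h2 := hconst 0 (1 / 2)
  norm_num at h1 h2
  linarith

/-- A finite union of hyperplanes has dense complement. -/
lemma dense_forall_inner_ne_zero {d : ℕ} {D : Set (EuclideanSpace ℝ (Fin d))} (hD : D.Finite) :
    Dense {n : EuclideanSpace ℝ (Fin d) | ∀ a ∈ D, a ≠ 0 → ⟪a, n⟫ ≠ 0} := by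
  have hset : {n : EuclideanSpace ℝ (Fin d) | ∀ a ∈ D, a ≠ 0 → ⟪a, n⟫ ≠ 0} =
      ⋂ a ∈ D, {n | a ≠ 0 → ⟪a, n⟫ ≠ 0} := by
    ext; simp
  rw [hset]
  refine dense_biInter_of_isOpen (fun a _ => ?_) hD.countable fun a _ => ?_
  · by_cases ha : a = 0
    · simp [ha]
    · simp only [ne_eq, ha, not_false_eq_true, forall_const]
      exact isOpen_ne_fun (by fun_prop) continuous_const
  · by_cases ha : a = 0
    · simp [ha]
    · simp only [ne_eq, ha, not_false_eq_true, forall_const]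
      have : {n : EuclideanSpace ℝ (Fin d) | ¬ ⟪a, n⟫ = 0} =
          ((ℝ ∙ a)ᗮ : Set (EuclideanSpace ℝ (Fin d)))ᶜ := by
        ext n
        simp [Submodule.mem_orthogonal_singleton_iff_inner_right]
      rw [this, ← interior_eq_empty_iff_dense_compl]
      by_contra hne
      have htop := Submodule.eq_top_of_nonempty_interior' _ (Set.nonempty_iff_ne_empty.2 hne)
      have : a ∈ (ℝ ∙ a)ᗮ := htop ▸ Submodule.mem_top
      rw [Submodule.mem_orthogonal_singleton_iff_inner_right] at this
      exact ha (inner_self_eq_zero.1 this)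

/-- If the support functions differ by a linear function, then one polytope is contained in a
translate of the other. -/
lemma add_mem_convexHull_of_supportFn_eq {d : ℕ} {S T : Finset (EuclideanSpace ℝ (Fin d))}
    (hS : S.Nonempty) (hT : T.Nonempty) {c : EuclideanSpace ℝ (Fin d)}
    (h : ∀ n, supportFn T hT n = supportFn S hS n + ⟪c, n⟫)
    {x : EuclideanSpace ℝ (Fin d)} (hx : x ∈ convexHull ℝ (S : Set _)) :
    c + x ∈ convexHull ℝ (T : Set (EuclideanSpace ℝ (Fin d))) := by
  by_contra hnot
  obtain ⟨φ, u, hφ, hu⟩ := geometric_hahn_banach_closed_point (convex_convexHull ℝ _)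
    (T.finite_toSet.isCompact_convexHull (𝕜 := ℝ)).isClosed hnot
  set n := (InnerProductSpace.toDual ℝ (EuclideanSpace ℝ (Fin d))).symm φ
  have hn : ∀ y, φ y = ⟪y, n⟫ := fun y => by
    rw [real_inner_comm, InnerProductSpace.toDual_symm_apply]
  obtain ⟨t, ht, htn⟩ := exists_inner_eq_supportFn hT n
  have h1 := hφ t (subset_convexHull ℝ _ ht)
  have h2 := inner_le_supportFn hS hx n
  rw [hn] at h1 hu
  rw [inner_add_left] at hu
  linarith [h n]

/-- If the faces with normal `n₀` are translates of each other, then the support functions differ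
by a linear function near `n₀`. -/
lemma eventually_supportFn_eq_of_face_eq {d : ℕ} {S T : Finset (EuclideanSpace ℝ (Fin d))}
    (hS : S.Nonempty) (hT : T.Nonempty) {n₀ v : EuclideanSpace ℝ (Fin d)}
    (hface : face (convexHull ℝ (T : Set _)) n₀ =
      (fun x => v + x) '' face (convexHull ℝ (S : Set (EuclideanSpace ℝ (Fin d)))) n₀) :
    ∀ᶠ n in 𝓝 n₀, supportFn T hT n = supportFn S hS n + ⟪v, n⟫ := by
  filter_upwards [eventually_exists_mem_face hS n₀, eventually_exists_mem_face hT n₀]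
    with n ⟨y, hy, hyn⟩ ⟨z, hz, hzn⟩
  apply le_antisymm
  · rw [hface] at hz
    obtain ⟨x, hx, rfl⟩ := hz
    rw [hzn, inner_add_left]
    linarith [inner_le_supportFn hS hx.1 n]
  · have hvy : v + y ∈ face (convexHull ℝ (T : Set _)) n₀ := hface ▸ ⟨y, hy, rfl⟩
    have := inner_le_supportFn hT hvy.1 n
    rw [inner_add_left] at this
    linarith

/-- Parallel faces of dimension at most one, neither of which fits properly inside the other,
are translates of each other. -/
lemma exists_face_eq_translate {d : ℕ} {S T : Finset (EuclideanSpace ℝ (Fin d))}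
    (hS : S.Nonempty) (hT : T.Nonempty) {n e : EuclideanSpace ℝ (Fin d)} (hn : n ≠ 0)
    (h : ∀ n : EuclideanSpace ℝ (Fin d), ‖n‖ = 1 →
      ¬ CanPutInside (face (convexHull ℝ (S : Set _)) n) (face (convexHull ℝ (T : Set _)) n) ∧
      ¬ CanPutInside (face (convexHull ℝ (T : Set _)) n) (face (convexHull ℝ (S : Set _)) n))
    (hSe : ∀ s ∈ S, ∀ s' ∈ S, ⟪s - s', n⟫ = 0 → s - s' ∈ Submodule.span ℝ {e})
    (hTe : ∀ s ∈ T, ∀ s' ∈ T, ⟪s - s', n⟫ = 0 → s - s' ∈ Submodule.span ℝ {e}) :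
    ∃ v, face (convexHull ℝ (T : Set _)) n =
      (fun x => v + x) '' face (convexHull ℝ (S : Set (EuclideanSpace ℝ (Fin d)))) n := by
  have hunit := h (‖n‖⁻¹ • n) (norm_smul_inv_norm hn)
  simp only [face_smul _ n (inv_pos.2 (norm_pos_iff.2 hn))] at hunit
  have key : ∀ {U : Finset (EuclideanSpace ℝ (Fin d))} (hU : U.Nonempty),
      (∀ s ∈ U, ∀ s' ∈ U, ⟪s - s', n⟫ = 0 → s - s' ∈ Submodule.span ℝ {e}) →
      (U.filter fun s => ⟪s, n⟫ = supportFn U hU n).Nonempty ∧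
      ∀ s ∈ U.filter (fun s => ⟪s, n⟫ = supportFn U hU n),
        ∀ s' ∈ U.filter (fun s => ⟪s, n⟫ = supportFn U hU n),
          s - s' ∈ Submodule.span ℝ {e} := by
    intro U hU hUe
    obtain ⟨s, hs, hsn⟩ := exists_inner_eq_supportFn hU n
    refine ⟨⟨s, Finset.mem_filter.2 ⟨hs, hsn.symm⟩⟩, fun a ha b hb => ?_⟩
    rw [Finset.mem_filter] at ha hb
    exact hUe a ha.1 b hb.1 (by rw [inner_sub_left, ha.2, hb.2, sub_self])
  have htrans := exists_translate_convexHull_subset (key hS hSe).1 (key hT hTe).1 e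
    (key hS hSe).2 (key hT hTe).2
  rw [← face_convexHull, ← face_convexHull] at htrans
  rcases htrans with ⟨v, hv⟩ | ⟨v, hv⟩
  · refine ⟨v, ?_⟩
    by_contra hne
    exact hunit.1 ⟨v, hv.ssubset_of_ne (Ne.symm hne)⟩
  · have heq : (fun x => v + x) '' face (convexHull ℝ (T : Set _)) n =
        face (convexHull ℝ (S : Set _)) n := by
      by_contra hne
      exact hunit.2 ⟨v, hv.ssubset_of_ne hne⟩
    refine ⟨-v, ?_⟩
    rw [← heq, Set.image_image]
    simp

/-- For generic `x` and `y`, no two linearly independent members of a given finite set are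
orthogonal to the same vector of the line through `x` and `y`. -/
lemma dense_forall_mem_span {d : ℕ} {D : Set (EuclideanSpace ℝ (Fin d))} (hD : D.Finite)
    (hd : 2 ≤ d) {x : EuclideanSpace ℝ (Fin d)} (hx0 : x ≠ 0)
    (hx : ∀ a ∈ D, a ≠ 0 → ⟪a, x⟫ ≠ 0) :
    Dense {y : EuclideanSpace ℝ (Fin d) | ∀ t : ℝ, x + t • (y - x) ≠ 0 ∧
      ∃ e, ∀ a ∈ D, ⟪a, x + t • (y - x)⟫ = 0 → a ∈ Submodule.span ℝ {e}} := by
  obtain ⟨w, hw, hw0⟩ : ∃ w ∈ (ℝ ∙ x)ᗮ, w ≠ 0 := by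
    refine Submodule.exists_mem_ne_zero_of_ne_bot fun hbot => ?_
    have h1 := Submodule.finrank_add_finrank_orthogonal (ℝ ∙ x)
    rw [hbot, finrank_bot, finrank_span_singleton hx0, finrank_euclideanSpace_fin] at h1
    omega
  rw [Submodule.mem_orthogonal_singleton_iff_inner_left] at hw
  have hfin : (insert w (Set.image2 (fun a b => ⟪a, x⟫ • b - ⟪b, x⟫ • a) D D)).Finite :=
    (hD.image2 _ hD).insert _
  refine (dense_forall_inner_ne_zero hfin).mono fun y hy t => ?_
  have hyw : ⟪w, y⟫ ≠ 0 := hy w (Set.mem_insert _ _) hw0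
  refine ⟨fun h0 => ?_, ?_⟩
  · have h1 : ⟪w, x + t • (y - x)⟫ = 0 := by rw [h0, inner_zero_right]
    simp only [inner_add_right, inner_smul_right, inner_sub_right, hw, sub_zero, zero_add] at h1
    have ht := (mul_eq_zero.1 h1).resolve_right hyw
    rw [ht, zero_smul, add_zero] at h0
    exact hx0 h0
  · by_cases hex : ∃ a ∈ D, a ≠ 0 ∧ ⟪a, x + t • (y - x)⟫ = 0
    · obtain ⟨a, ha, ha0, hat⟩ := hex
      refine ⟨a, fun b hb hbt => ?_⟩
      have hax := hx a ha ha0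
      simp only [inner_add_right, inner_smul_right, inner_sub_right] at hat hbt
      have ht : t ≠ 0 := by
        rintro rfl
        simp only [zero_mul, add_zero] at hat
        exact hax hat
      have hc : ⟪a, x⟫ • b - ⟪b, x⟫ • a = 0 := by
        by_contra hne
        refine hy _ (Set.mem_insert_of_mem _ ⟨a, ha, b, hb, rfl⟩) hne ?_
        refine (mul_eq_zero.1 ?_).resolve_left ht
        simp only [inner_sub_left, inner_smul_left, conj_trivial]
        linear_combination ⟪a, x⟫ * hbt - ⟪b, x⟫ * hat
      refine Submodule.mem_span_singleton.2 ⟨⟪a, x⟫⁻¹ * ⟪b, x⟫, ?_⟩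
      rw [mul_smul, ← sub_eq_zero.1 hc, inv_smul_smul₀ hax]
    · refine ⟨0, fun a ha hat => ?_⟩
      by_contra hne
      exact hex ⟨a, ha, fun h0 => hne (by simp [h0]), hat⟩

/-- Under the hypothesis on faces, the difference of the support functions is additive. -/
lemma supportFn_sub_add {d : ℕ} (hd : 2 ≤ d) {S T : Finset (EuclideanSpace ℝ (Fin d))}
    (hS : S.Nonempty) (hT : T.Nonempty)
    (h : ∀ n : EuclideanSpace ℝ (Fin d), ‖n‖ = 1 →
      ¬ CanPutInside (face (convexHull ℝ (S : Set _)) n) (face (convexHull ℝ (T : Set _)) n) ∧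
      ¬ CanPutInside (face (convexHull ℝ (T : Set _)) n) (face (convexHull ℝ (S : Set _)) n))
    (x y : EuclideanSpace ℝ (Fin d)) :
    supportFn T hT (x + y) - supportFn S hS (x + y) =
      (supportFn T hT x - supportFn S hS x) + (supportFn T hT y - supportFn S hS y) := by
  have hcS := continuous_supportFn hS
  have hcT := continuous_supportFn hT
  have : Nontrivial (EuclideanSpace ℝ (Fin d)) :=
    Module.nontrivial_of_finrank_pos (R := ℝ) (by rw [finrank_euclideanSpace_fin]; omega)
  obtain ⟨u, hu⟩ := exists_ne (0 : EuclideanSpace ℝ (Fin d))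
  set D : Set (EuclideanSpace ℝ (Fin d)) :=
    Set.image2 (fun a b => a - b) S S ∪ Set.image2 (fun a b => a - b) T T with hDdef
  have hD : D.Finite := (S.finite_toSet.image2 _ S.finite_toSet).union
    (T.finite_toSet.image2 _ T.finite_toSet)
  have hdense := dense_forall_inner_ne_zero (hD.insert u)
  refine hdense.induction (P := fun x => supportFn T hT (x + y) - supportFn S hS (x + y) =
      (supportFn T hT x - supportFn S hS x) + (supportFn T hT y - supportFn S hS y))
    (fun x hx => ?_) (isClosed_eq (by fun_prop) (by fun_prop)) x
  have hx0 : x ≠ 0 := by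
    rintro rfl
    exact hx u (Set.mem_insert _ _) hu (inner_zero_right _)
  have hx' : ∀ a ∈ D, a ≠ 0 → ⟪a, x⟫ ≠ 0 := fun a ha => hx a (Set.mem_insert_of_mem _ ha)
  refine (dense_forall_mem_span hD hd hx0 hx').induction
    (P := fun y => supportFn T hT (x + y) - supportFn S hS (x + y) =
      (supportFn T hT x - supportFn S hS x) + (supportFn T hT y - supportFn S hS y))
    (fun y hy => ?_) (isClosed_eq (by fun_prop) (by fun_prop)) y
  have hline := add_eq_two_mul_of_eventually_affine
    (g := fun t => supportFn T hT (x + t • (y - x)) - supportFn S hS (x + t • (y - x)))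
    fun t₀ => by
      obtain ⟨hne, e, he⟩ := hy t₀
      obtain ⟨v, hv⟩ := exists_face_eq_translate hS hT hne h
        (fun s hs s' hs' => he _ (Or.inl ⟨s, hs, s', hs', rfl⟩))
        (fun s hs s' hs' => he _ (Or.inr ⟨s, hs, s', hs', rfl⟩))
      have hcont : Continuous fun t : ℝ => x + t • (y - x) := by fun_prop
      refine ⟨⟪v, x⟫, ⟪v, y - x⟫, ?_⟩
      filter_upwards [hcont.continuousAt.eventually
        (eventually_supportFn_eq_of_face_eq hS hT hv)] with t ht
      rw [ht, inner_add_right, inner_smul_right]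
      ring
  have hmid : x + (1 / 2 : ℝ) • (y - x) = (1 / 2 : ℝ) • (x + y) := by module
  simp only [hmid, zero_smul, add_zero, one_smul, add_sub_cancel,
    supportFn_smul _ (by norm_num : (0 : ℝ) ≤ 1 / 2)] at hline
  linarith

/-- **Theorem 2.4.** If no face of either polytope can be translated into a proper subset of
the parallel face of the other, then the polytopes are translates of each other. -/
theorem alexandrov_type_uniqueness (d : ℕ) (hd : 2 ≤ d)
    (P₁ P₂ : Set (EuclideanSpace ℝ (Fin d)))
    (h₁ : IsConvexPolytope P₁) (h₂ : IsConvexPolytope P₂)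
    (h : ∀ n : EuclideanSpace ℝ (Fin d), ‖n‖ = 1 →
      ¬ CanPutInside (face P₁ n) (face P₂ n) ∧ ¬ CanPutInside (face P₂ n) (face P₁ n)) :
    IsTranslate P₁ P₂ := by
  obtain ⟨⟨S, rfl⟩, hSi⟩ := h₁
  obtain ⟨⟨T, rfl⟩, hTi⟩ := h₂
  have hS : S.Nonempty := by
    simpa using hSi.mono interior_subset
  have hT : T.Nonempty := by
    simpa using hTi.mono interior_subset
  let f : EuclideanSpace ℝ (Fin d) →+ ℝ :=
    AddMonoidHom.mk' (fun n => supportFn T hT n - supportFn S hS n) (supportFn_sub_add hd hS hT h)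
  have hf : Continuous f := (continuous_supportFn hT).sub (continuous_supportFn hS)
  set c := (InnerProductSpace.toDual ℝ (EuclideanSpace ℝ (Fin d))).symm (f.toRealLinearMap hf)
  have hc : ∀ n, supportFn T hT n - supportFn S hS n = ⟪c, n⟫ := fun n => by
    rw [InnerProductSpace.toDual_symm_apply]
    rfl
  refine ⟨c, Set.Subset.antisymm (fun y hy => ?_) ?_⟩
  · refine ⟨-c + y, add_mem_convexHull_of_supportFn_eq hT hS (fun n => ?_) hy, by simp⟩
    rw [inner_neg_left]
    linarith [hc n]
  · rintro _ ⟨x, hx, rfl⟩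
    exact add_mem_convexHull_of_supportFn_eq hS hT (fun n => by linarith [hc n]) hx
end
end

section
/- Let d ≥ 2, let n_1,...,n_m be unit vectors in R^d not all contained in any closed half-space bounded by a hyperplane through the origin, and let f_1,...,f_m be positive reals with Σ f_j n_j = 0. Then there exists a convex polytope P in R^d whose (d-1)-dimensional faces have exactly n_1,...,n_m as their unit outward normal vectors, with the face normal to n_j having (d-1)-dimensional volume f_j. -/
open MeasureTheory

noncomputable section

namespace MinkowskiExistence

open Set Filter Topology Module
open scoped RealInnerProductSpace Pointwise

section Polyhedron

variable {ι E : Type*} [NormedAddCommGroup E] [InnerProductSpace ℝ E]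

/-- The intersection of the half-spaces `{x | ⟪x, n i⟫ ≤ h i}`. -/
def polyhedron (n : ι → E) (h : ι → ℝ) : Set E := {x | ∀ i, ⟪x, n i⟫ ≤ h i}

lemma polyhedron_mono (n : ι → E) {h h' : ι → ℝ} (hh : h ≤ h') :
    polyhedron n h ⊆ polyhedron n h' :=
  fun _ hx i => (hx i).trans (hh i)

lemma isClosed_polyhedron (n : ι → E) (h : ι → ℝ) : IsClosed (polyhedron n h) := by
  simp only [polyhedron, ofPred_forall]
  exact isClosed_iInter fun i => isClosed_le (by fun_prop) continuous_const

lemma convex_polyhedron (n : ι → E) (h : ι → ℝ) : Convex ℝ (polyhedron n h) := by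
  intro x hx y hy a b ha hb hab i
  rw [inner_add_left, real_inner_smul_left, real_inner_smul_left]
  calc a * ⟪x, n i⟫ + b * ⟪y, n i⟫ ≤ a * h i + b * h i :=
        add_le_add (mul_le_mul_of_nonneg_left (hx i) ha) (mul_le_mul_of_nonneg_left (hy i) hb)
    _ = h i := by rw [← add_mul, hab, one_mul]

lemma polyhedron_smul (n : ι → E) (h : ι → ℝ) {r : ℝ} (hr : 0 < r) :
    polyhedron n (r • h) = r • polyhedron n h := by
  ext x
  rw [mem_smul_set_iff_inv_smul_mem₀ hr.ne']
  refine forall_congr' fun i => ?_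
  rw [real_inner_smul_left, inv_mul_le_iff₀ hr, Pi.smul_apply, smul_eq_mul]

lemma polyhedron_translate (n : ι → E) (h : ι → ℝ) (v : E) :
    polyhedron n (fun i => h i + ⟪v, n i⟫) = (fun x => v + x) '' polyhedron n h := by
  ext x
  simp only [image_add_left, mem_preimage]
  refine forall_congr' fun i => ?_
  rw [inner_add_left, inner_neg_left]
  constructor <;> intro hx <;> linarith

/-- Closedness of the polygon of forces `∑ i, f i • n i = 0` bounds every polyhedron with
normals `n i`. -/
lemma isCompact_polyhedron [Fintype ι] [FiniteDimensional ℝ E] {n : ι → E} {f : ι → ℝ}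
    (hspan : ∀ x : E, (∀ i, ⟪x, n i⟫ = 0) → x = 0) (hpos : ∀ i, 0 < f i)
    (hsum : ∑ i, f i • n i = 0) (h : ι → ℝ) : IsCompact (polyhedron n h) := by
  classical
  let T : E →ₗ[ℝ] (ι → ℝ) := LinearMap.pi fun i => (innerₛₗ ℝ (n i) : E →ₗ[ℝ] ℝ)
  have hT : ∀ x i, T x i = ⟪x, n i⟫ := fun x i => by
    simp [T, real_inner_comm]
  have hker : LinearMap.ker T = ⊥ := by
    rw [LinearMap.ker_eq_bot']
    intro x hx
    refine hspan x fun i => ?_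
    rw [← hT, hx, Pi.zero_apply]
  let a : ι → ℝ := fun i => -((f i)⁻¹ * ∑ j ∈ Finset.univ.erase i, f j * h j)
  have hsub : polyhedron n h ⊆ T ⁻¹' Icc a h := by
    intro x hx
    refine ⟨fun i => ?_, fun i => ?_⟩
    · have h0 : ∑ j, f j * ⟪x, n j⟫ = 0 := by
        have := congrArg (fun y => ⟪x, y⟫) hsum
        simpa [inner_sum, real_inner_smul_right] using this
      rw [← Finset.add_sum_erase _ _ (Finset.mem_univ i)] at h0
      have h1 : ∑ j ∈ Finset.univ.erase i, f j * ⟪x, n j⟫ ≤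
          ∑ j ∈ Finset.univ.erase i, f j * h j :=
        Finset.sum_le_sum fun j _ => mul_le_mul_of_nonneg_left (hx j) (hpos j).le
      rw [hT]
      simp only [a]
      rw [neg_le, inv_mul_eq_div, le_div_iff₀ (hpos i)]
      linarith
    · rw [hT]
      exact hx i
  exact ((T.isClosedEmbedding_of_injective hker).isCompact_preimage isCompact_Icc).of_isClosed_subset
    (isClosed_polyhedron n h) hsub

end Polyhedron

section Extremal

variable {ι E : Type*} [Fintype ι] [NormedAddCommGroup E] [InnerProductSpace ℝ E]
  [FiniteDimensional ℝ E] [MeasurableSpace E] [BorelSpace E] {n : ι → E}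

lemma upperSemicontinuous_volume_polyhedron (hc : ∀ h, IsCompact (polyhedron n h)) :
    UpperSemicontinuous fun h => volume.real (polyhedron n h) := by
  intro h c hlt
  have hanti : Antitone fun k : ℕ => polyhedron n fun i => h i + 1 / ((k : ℝ) + 1) := by
    intro k l hkl
    refine polyhedron_mono n fun i => ?_
    gcongr
  have hInter : ⋂ k : ℕ, polyhedron n (fun i => h i + 1 / ((k : ℝ) + 1)) = polyhedron n h := by
    refine Subset.antisymm (fun x hx i => ?_) (subset_iInter fun k => polyhedron_mono n fun i => ?_)
    · have hlim : Tendsto (fun k : ℕ => h i + 1 / ((k : ℝ) + 1)) atTop (𝓝 (h i + 0)) :=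
        tendsto_const_nhds.add tendsto_one_div_add_atTop_nhds_zero_nat
      rw [add_zero] at hlim
      exact ge_of_tendsto' hlim fun k => mem_iInter.1 hx k i
    · have : (0 : ℝ) < 1 / ((k : ℝ) + 1) := by positivity
      linarith
  have hlim := tendsto_measure_iInter_atTop (μ := (volume : Measure E))
    (fun k => (hc _).measurableSet.nullMeasurableSet) hanti ⟨0, (hc _).measure_lt_top.ne⟩
  rw [hInter] at hlim
  have hlim' := (ENNReal.tendsto_toReal (hc h).measure_lt_top.ne).comp hlim
  obtain ⟨k, hk⟩ := (hlim'.eventually_lt_const hlt).exists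
  have hnear : ∀ᶠ h' in 𝓝 h, ∀ i, h' i ≤ h i + 1 / ((k : ℝ) + 1) := by
    rw [eventually_all]
    intro i
    have : (0 : ℝ) < 1 / ((k : ℝ) + 1) := by positivity
    exact ((continuous_apply i).tendsto h).eventually_le_const (by linarith)
  filter_upwards [hnear] with h' hh'
  exact (measureReal_mono (polyhedron_mono n hh') (hc _).measure_lt_top.ne).trans_lt hk

/-- Among the polyhedra with normals `n i` there is one maximizing the volume, relative to the
`finrank ℝ E`-th power of the weighted sum `∑ i, f i * h i` of its support numbers. -/
lemma exists_polyhedron_maximizing_volume [Nonempty ι] {f : ι → ℝ}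
    (hunit : ∀ i, ‖n i‖ = 1) (hpos : ∀ i, 0 < f i) (hsum : ∑ i, f i • n i = 0)
    (hc : ∀ h, IsCompact (polyhedron n h)) :
    ∃ h : ι → ℝ, ∑ i, f i * h i = 1 ∧ 0 < volume.real (polyhedron n h) ∧
      ∀ h' : ι → ℝ, 0 < ∑ i, f i * h' i → volume.real (polyhedron n h') ≤
        volume.real (polyhedron n h) * (∑ i, f i * h' i) ^ finrank ℝ E := by
  let K : Set (ι → ℝ) := {h | (∀ i, 0 ≤ h i) ∧ ∑ i, f i * h i = 1}
  have hKclosed : IsClosed K := by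
    have h1 : IsClosed {h : ι → ℝ | ∀ i, 0 ≤ h i} := by
      simp only [ofPred_forall]
      exact isClosed_iInter fun i => isClosed_le continuous_const (by fun_prop)
    exact h1.inter (isClosed_eq (by fun_prop) continuous_const)
  have hKsub : K ⊆ Icc 0 fun i => (f i)⁻¹ := by
    intro h hh
    refine ⟨fun i => hh.1 i, fun i => ?_⟩
    have := Finset.single_le_sum (f := fun i => f i * h i)
      (fun j _ => mul_nonneg (hpos j).le (hh.1 j)) (Finset.mem_univ i)
    rw [hh.2] at this
    show h i ≤ (f i)⁻¹
    rwa [← one_div, le_div_iff₀' (hpos i)]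
  have hKc : IsCompact K := isCompact_Icc.of_isClosed_subset hKclosed hKsub
  have hS : 0 < ∑ i, f i := Finset.sum_pos (fun i _ => hpos i) Finset.univ_nonempty
  let h₀ : ι → ℝ := fun _ => (∑ i, f i)⁻¹
  have h₀K : h₀ ∈ K := by
    refine ⟨fun i => by positivity, ?_⟩
    rw [← Finset.sum_mul, mul_inv_cancel₀ hS.ne']
  have h₀pos : 0 < volume.real (polyhedron n h₀) := by
    refine ENNReal.toReal_pos (ne_of_gt ?_) (hc _).measure_lt_top.ne
    refine (Metric.measure_ball_pos volume (0 : E) (inv_pos.2 hS)).trans_le (measure_mono ?_)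
    intro x hx i
    have := real_inner_le_norm x (n i)
    rw [hunit, mul_one] at this
    exact this.trans (mem_ball_zero_iff.1 hx).le
  obtain ⟨h, hhK, hmax⟩ := ((upperSemicontinuous_volume_polyhedron hc).upperSemicontinuousOn
    K).exists_isMaxOn ⟨h₀, h₀K⟩ hKc
  refine ⟨h, hhK.2, h₀pos.trans_le (hmax h₀K), fun h' hL => ?_⟩
  set L := ∑ i, f i * h' i with hLdef
  rcases (polyhedron n h').eq_empty_or_nonempty with he | ⟨v, hv⟩
  · rw [he, measureReal_empty]
    positivity
  let g : ι → ℝ := L⁻¹ • fun i => h' i + ⟪-v, n i⟫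
  have hgK : g ∈ K := by
    refine ⟨fun i => ?_, ?_⟩
    · have := hv i
      simp only [g, Pi.smul_apply, smul_eq_mul, inner_neg_left]
      exact mul_nonneg (inv_pos.2 hL).le (by linarith)
    · have h0 : ∑ j, f j * ⟪-v, n j⟫ = 0 := by
        have := congrArg (fun y => ⟪-v, y⟫) hsum
        simpa [inner_sum, real_inner_smul_right] using this
      calc ∑ i, f i * g i = L⁻¹ * (L + ∑ i, f i * ⟪-v, n i⟫) := by
            rw [hLdef, ← Finset.sum_add_distrib, Finset.mul_sum]
            refine Finset.sum_congr rfl fun i _ => ?_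
            simp only [g, Pi.smul_apply, smul_eq_mul]
            ring
        _ = 1 := by rw [h0, add_zero, inv_mul_cancel₀ hL.ne']
  have hg : volume.real (polyhedron n g) ≤ volume.real (polyhedron n h) := hmax hgK
  rw [polyhedron_smul _ _ (inv_pos.2 hL), polyhedron_translate, measureReal_def,
    Measure.addHaar_smul, image_add_left, measure_preimage_add, ENNReal.toReal_mul,
    ENNReal.toReal_ofReal (abs_nonneg _), abs_of_nonneg (by positivity), inv_pow,
    inv_mul_le_iff₀ (by positivity), mul_comm] at hg
  exact hg

end Extremal

section Slices

variable {ι E : Type*} [NormedAddCommGroup E] [InnerProductSpace ℝ E] {k : ℕ}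

lemma volume_inner_eq_const [FiniteDimensional ℝ E] [MeasurableSpace E] [BorelSpace E]
    {F : Type*} [NormedAddCommGroup F] [InnerProductSpace ℝ F] (e : E →ₗᵢ[ℝ] F)
    {w : F} (hw : ∃ y, ⟪e y, w⟫ ≠ 0) (c : ℝ) :
    volume {y : E | ⟪e y, w⟫ = c} = 0 := by
  rcases {y : E | ⟪e y, w⟫ = c}.eq_empty_or_nonempty with he | ⟨y₀, hy₀⟩
  · rw [he, measure_empty]
  let φ : E →ₗ[ℝ] ℝ := (innerₛₗ ℝ w : F →ₗ[ℝ] ℝ) ∘ₗ e.toLinearMap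
  have hφ : ∀ y, φ y = ⟪e y, w⟫ := fun y => by simp [φ, real_inner_comm]
  let s := AffineSubspace.mk' y₀ (LinearMap.ker φ)
  have hs : {y : E | ⟪e y, w⟫ = c} ⊆ s := by
    intro y hy
    have hy₀' : ⟪e y₀, w⟫ = c := hy₀
    have hy' : ⟪e y, w⟫ = c := hy
    show y ∈ s
    rw [AffineSubspace.mem_mk', LinearMap.mem_ker, vsub_eq_sub, map_sub, hφ, hφ, hy', hy₀', sub_self]
  refine measure_mono_null hs (Measure.addHaar_affineSubspace volume s fun htop => ?_)
  obtain ⟨y, hy⟩ := hw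
  have hdir : (s : AffineSubspace ℝ E).direction = ⊤ := by rw [htop, AffineSubspace.direction_top]
  rw [AffineSubspace.direction_mk'] at hdir
  refine hy ?_
  rw [← hφ, ← LinearMap.mem_ker, hdir]
  trivial

/-- Isometric coordinates on the hyperplane orthogonal to a unit vector `ν`; together with the
height along `ν` they are volume-preserving coordinates on the whole space. -/
lemma exists_hyperplane_coordinates [FiniteDimensional ℝ E] [MeasurableSpace E] [BorelSpace E]
    (hE : finrank ℝ E = k + 1) {ν : E} (hν : ‖ν‖ = 1) :
    ∃ e : EuclideanSpace ℝ (Fin k) →ₗᵢ[ℝ] E, (∀ y, ⟪e y, ν⟫ = 0) ∧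
      (∀ x, ⟪x, ν⟫ = 0 → ∃ y, e y = x) ∧
      MeasurePreserving (fun p : ℝ × EuclideanSpace ℝ (Fin k) => p.1 • ν + e p.2) := by
  have hν0 : ν ≠ 0 := norm_ne_zero_iff.1 (by rw [hν]; exact one_ne_zero)
  have : Fact (finrank ℝ E = k + 1) := ⟨hE⟩
  have hfin : finrank ℝ (ℝ ∙ ν)ᗮ = k := Submodule.finrank_orthogonal_span_singleton hν0
  let b := (stdOrthonormalBasis ℝ (ℝ ∙ ν)ᗮ).reindex (finCongr hfin)
  let e : EuclideanSpace ℝ (Fin k) →ₗᵢ[ℝ] E :=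
    (ℝ ∙ ν)ᗮ.subtypeₗᵢ.comp b.repr.symm.toLinearIsometry
  have heo : ∀ y, ⟪e y, ν⟫ = 0 := fun y =>
    Submodule.mem_orthogonal_singleton_iff_inner_left.1 (b.repr.symm y).2
  refine ⟨e, heo, fun x hx => ?_, ?_⟩
  · refine ⟨b.repr ⟨x, Submodule.mem_orthogonal_singleton_iff_inner_left.2 hx⟩, ?_⟩
    simp [e]
  let g : WithLp 2 (ℝ × EuclideanSpace ℝ (Fin k)) →ₗ[ℝ] E :=
    { toFun := fun p => p.fst • ν + e p.snd
      map_add' := fun p q => by simp only [WithLp.add_fst, WithLp.add_snd, map_add, add_smul]; abel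
      map_smul' := fun r p => by
        simp only [WithLp.smul_fst, WithLp.smul_snd, map_smul, smul_add, smul_smul, smul_eq_mul,
          RingHom.id_apply] }
  have hg : ∀ p, ‖g p‖ = ‖p‖ := by
    intro p
    rw [← sq_eq_sq₀ (norm_nonneg _) (norm_nonneg _), WithLp.prod_norm_sq_eq_of_L2]
    show ‖p.fst • ν + e p.snd‖ ^ 2 = _
    rw [norm_add_sq_real, real_inner_smul_left, real_inner_comm, heo, norm_smul, hν, e.norm_map]
    ring
  let G : WithLp 2 (ℝ × EuclideanSpace ℝ (Fin k)) ≃ₗᵢ[ℝ] E :=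
    LinearIsometry.toLinearIsometryEquiv ⟨g, hg⟩ (by
      rw [(WithLp.linearEquiv 2 ℝ (ℝ × EuclideanSpace ℝ (Fin k))).finrank_eq, hE]
      simp [add_comm])
  exact G.measurePreserving.comp (WithLp.volume_preserving_toLp ℝ (EuclideanSpace ℝ (Fin k)))

/-- The part of the hyperplane `{x | ⟪x, n j⟫ = h j}`, in the coordinates `e`, where the
constraints other than `j` hold up to the tolerance `t`. -/
def facetSlice (n : ι → E) (h : ι → ℝ) (j : ι) (e : EuclideanSpace ℝ (Fin k) →ₗᵢ[ℝ] E) (t : ℝ) :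
    Set (EuclideanSpace ℝ (Fin k)) :=
  {y | ∀ i, i ≠ j → ⟪e y, n i⟫ ≤ h i - h j * ⟪n j, n i⟫ + t}

variable {n : ι → E} {h : ι → ℝ} {j : ι} {e : EuclideanSpace ℝ (Fin k) →ₗᵢ[ℝ] E}

lemma facetSlice_mono {s t : ℝ} (hst : s ≤ t) : facetSlice n h j e s ⊆ facetSlice n h j e t :=
  fun _ hy i hi => (hy i hi).trans (by linarith)

lemma isCompact_facetSlice (hc : ∀ h, IsCompact (polyhedron n h)) (hj : ‖n j‖ = 1)
    (he : ∀ y, ⟪e y, n j⟫ = 0) (t : ℝ) : IsCompact (facetSlice n h j e t) := by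
  have hclosed : IsClosed (facetSlice n h j e t) := by
    simp only [facetSlice, ofPred_forall]
    exact isClosed_iInter fun i => isClosed_iInter fun _ =>
      isClosed_le (by fun_prop) continuous_const
  have hiso : Isometry fun y => h j • n j + e y :=
    (IsometryEquiv.addLeft (h j • n j)).isometry.comp e.isometry
  refine (hiso.isClosedEmbedding.isCompact_preimage
    (hc fun i => h i + |t|)).of_isClosed_subset hclosed fun y hy i => ?_
  rw [inner_add_left, real_inner_smul_left]
  by_cases hi : i = j
  · subst hi
    rw [he, real_inner_self_eq_norm_sq, hj]
    linarith [abs_nonneg t]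
  · linarith [hy i hi, le_abs_self t]

lemma mem_facetSlice_zero (hj : ‖n j‖ = 1) (he : ∀ y, ⟪e y, n j⟫ = 0)
    (y : EuclideanSpace ℝ (Fin k)) :
    y ∈ facetSlice n h j e 0 ↔ h j • n j + e y ∈ polyhedron n h := by
  refine forall_congr' fun i => ?_
  rw [inner_add_left, real_inner_smul_left]
  by_cases hi : i = j
  · subst hi
    simp [he, hj]
  · simp only [hi, ne_eq, not_false_eq_true, true_imp_iff]
    constructor <;> intro _ <;> linarith

lemma abs_mul_inner_le {s t : ℝ} {u v : E} (hs : |s| ≤ t) (hu : ‖u‖ = 1) (hv : ‖v‖ = 1) :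
    |s * ⟪u, v⟫| ≤ t := by
  have h1 : |⟪u, v⟫| ≤ 1 := by simpa [hu, hv] using abs_real_inner_le_norm u v
  rw [abs_mul]
  calc |s| * |⟪u, v⟫| ≤ |s| * 1 := mul_le_mul_of_nonneg_left h1 (abs_nonneg s)
    _ ≤ t := by rwa [mul_one]

variable [FiniteDimensional ℝ E] [MeasurableSpace E] [BorelSpace E] [DecidableEq ι]

lemma mul_volume_facetSlice_le (hc : ∀ h, IsCompact (polyhedron n h)) (hunit : ∀ i, ‖n i‖ = 1)
    (he : ∀ y, ⟪e y, n j⟫ = 0)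
    (hmp : MeasurePreserving (fun p : ℝ × EuclideanSpace ℝ (Fin k) => p.1 • n j + e p.2))
    {t : ℝ} (ht : 0 < t) :
    t * volume.real (facetSlice n h j e (-t)) ≤
      volume.real (polyhedron n (Function.update h j (h j + t))) -
        volume.real (polyhedron n h) := by
  set Q := polyhedron n (Function.update h j (h j + t))
  have hPQ : polyhedron n h ⊆ Q := polyhedron_mono n fun i => by
    by_cases hi : i = j
    · subst hi; simp [ht.le]
    · simp [hi]
  have hsub : Ioc (h j) (h j + t) ×ˢ facetSlice n h j e (-t) ⊆
      (fun p : ℝ × EuclideanSpace ℝ (Fin k) => p.1 • n j + e p.2) ⁻¹' (Q \ polyhedron n h) := by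
    rintro ⟨s, y⟩ ⟨⟨hs1, hs2⟩, hy⟩
    refine ⟨fun i => ?_, fun hP => ?_⟩
    · rw [inner_add_left, real_inner_smul_left]
      by_cases hi : i = j
      · subst hi
        simpa [he, real_inner_self_eq_norm_sq, hunit] using hs2
      · have h1 := abs_mul_inner_le (s := s - h j) (t := t)
          (abs_le.2 ⟨by simp only at hs1; linarith, by simp only at hs2; linarith⟩) (hunit j)
          (hunit i)
        have h2 := hy i hi
        simp only [ne_eq, hi, not_false_eq_true, Function.update_of_ne] at h2 ⊢
        linarith [(abs_le.1 h1).2]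
    · have := hP j
      simp only [inner_add_left, real_inner_smul_left, he, real_inner_self_eq_norm_sq, hunit] at this
      simp only at hs1
      linarith
  have hdiff := measureReal_sdiff (μ := (volume : Measure E)) hPQ (hc h).measurableSet
    (hc _).measure_lt_top.ne
  rw [← hdiff, ← hmp.measureReal_preimage
    ((hc _).measurableSet.diff (hc _).measurableSet).nullMeasurableSet]
  refine le_trans (le_of_eq ?_) (measureReal_mono hsub ?_)
  · rw [Measure.volume_eq_prod, measureReal_prod_prod, Real.volume_real_Ioc_of_le (by linarith)]
    ring
  · rw [hmp.measure_preimage ((hc _).measurableSet.diff (hc _).measurableSet).nullMeasurableSet]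
    exact ((measure_mono sdiff_subset).trans_lt (hc _).measure_lt_top).ne

lemma sub_le_mul_volume_facetSlice (hc : ∀ h, IsCompact (polyhedron n h))
    (hunit : ∀ i, ‖n i‖ = 1) (he : ∀ y, ⟪e y, n j⟫ = 0)
    (hmp : MeasurePreserving (fun p : ℝ × EuclideanSpace ℝ (Fin k) => p.1 • n j + e p.2))
    {t : ℝ} (ht : 0 < t) :
    volume.real (polyhedron n h) -
        volume.real (polyhedron n (Function.update h j (h j - t))) ≤
      t * volume.real (facetSlice n h j e t) := by
  set R := polyhedron n (Function.update h j (h j - t)) with hR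
  have hRP : R ⊆ polyhedron n h := polyhedron_mono n fun i => by
    by_cases hi : i = j
    · subst hi; simp [ht.le]
    · simp [hi]
  have hsub : (fun p : ℝ × EuclideanSpace ℝ (Fin k) => p.1 • n j + e p.2) ⁻¹'
      (polyhedron n h \ R) ⊆ Ioc (h j - t) (h j) ×ˢ facetSlice n h j e t := by
    rintro ⟨s, y⟩ ⟨hP, hnR⟩
    have hP' : ∀ i, s * ⟪n j, n i⟫ + ⟪e y, n i⟫ ≤ h i := fun i => by
      have := hP i
      rwa [inner_add_left, real_inner_smul_left] at this
    have hs2 : s ≤ h j := by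
      simpa [he, real_inner_self_eq_norm_sq, hunit] using hP' j
    have hs1 : h j - t < s := by
      by_contra hs
      refine hnR fun i => ?_
      rw [inner_add_left, real_inner_smul_left]
      by_cases hi : i = j
      · subst hi
        simpa [he, real_inner_self_eq_norm_sq, hunit] using hs
      · simpa [hi] using hP' i
    refine ⟨⟨hs1, hs2⟩, fun i hi => ?_⟩
    have h1 := abs_mul_inner_le (s := s - h j) (t := t)
      (abs_le.2 ⟨by linarith, by linarith⟩) (hunit j) (hunit i)
    have h2 := hP' i
    show ⟪e y, n i⟫ ≤ _
    linarith [(abs_le.1 h1).1]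
  have hdiff := measureReal_sdiff (μ := (volume : Measure E)) hRP (hc _).measurableSet
    (hc _).measure_lt_top.ne
  rw [← hdiff, ← hmp.measureReal_preimage
    ((hc _).measurableSet.diff (hc _).measurableSet).nullMeasurableSet]
  refine (measureReal_mono hsub ?_).trans (le_of_eq ?_)
  · rw [Measure.volume_eq_prod, Measure.prod_prod]
    exact ENNReal.mul_ne_top measure_Ioc_lt_top.ne
      (isCompact_facetSlice hc (hunit j) he t).measure_lt_top.ne
  · rw [Measure.volume_eq_prod, measureReal_prod_prod, Real.volume_real_Ioc_of_le (by linarith)]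
    ring

end Slices

section FacetVolume

variable {ι E : Type*} [NormedAddCommGroup E] [InnerProductSpace ℝ E]
  {k : ℕ} {n : ι → E} {h : ι → ℝ} {j : ι} {e : EuclideanSpace ℝ (Fin k) →ₗᵢ[ℝ] E}

lemma exists_inner_ne_zero_or_eq (hunit : ∀ i, ‖n i‖ = 1) (hinj : Function.Injective n)
    (hsurj : ∀ x, ⟪x, n j⟫ = 0 → ∃ y, e y = x) {i : ι} (hi : i ≠ j) :
    (∃ y, ⟪e y, n i⟫ ≠ 0) ∨ n i = -n j := by
  by_contra! hcon
  obtain ⟨hz, hne⟩ := hcon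
  have horth : ⟪n i - ⟪n i, n j⟫ • n j, n j⟫ = 0 := by
    rw [inner_sub_left, real_inner_smul_left, real_inner_self_eq_norm_sq, hunit]
    ring
  obtain ⟨y, hy⟩ := hsurj _ horth
  have hself : ⟪n i - ⟪n i, n j⟫ • n j, n i - ⟪n i, n j⟫ • n j⟫ = 0 := by
    rw [inner_sub_right, real_inner_smul_right, horth, ← hy, hz, mul_zero, sub_zero]
  have heq : n i = ⟪n i, n j⟫ • n j := sub_eq_zero.1 (inner_self_eq_zero.1 hself)
  have habs : |⟪n i, n j⟫| = 1 := by
    have := congrArg norm heq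
    rwa [norm_smul, hunit, hunit, mul_one, Real.norm_eq_abs, eq_comm] at this
  rcases eq_or_eq_neg_of_abs_eq habs with h1 | h1
  · rw [h1, one_smul] at heq
    exact hi (hinj heq)
  · rw [h1, neg_one_smul] at heq
    exact hne heq

lemma facetSlice_zero_eq_iInter :
    facetSlice n h j e 0 = ⋂ m : ℕ, facetSlice n h j e (1 / ((m : ℝ) + 1)) := by
  refine Subset.antisymm (subset_iInter fun m => facetSlice_mono (by positivity)) ?_
  intro y hy i hi
  have hlim : Tendsto (fun m : ℕ => h i - h j * ⟪n j, n i⟫ + 1 / ((m : ℝ) + 1)) atTop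
      (𝓝 (h i - h j * ⟪n j, n i⟫ + 0)) :=
    tendsto_const_nhds.add tendsto_one_div_add_atTop_nhds_zero_nat
  exact ge_of_tendsto' hlim fun m => mem_iInter.1 hy m i hi

lemma volume_facetSlice_zero_sdiff [Finite ι] (hunit : ∀ i, ‖n i‖ = 1) (hinj : Function.Injective n)
    (hinner : ∃ x, ∀ i, ⟪x, n i⟫ < h i) (he : ∀ y, ⟪e y, n j⟫ = 0)
    (hsurj : ∀ x, ⟪x, n j⟫ = 0 → ∃ y, e y = x) :
    volume (facetSlice n h j e 0 \ ⋃ m : ℕ, facetSlice n h j e (-(1 / ((m : ℝ) + 1)))) = 0 := by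
  have hsub : facetSlice n h j e 0 \ ⋃ m : ℕ, facetSlice n h j e (-(1 / ((m : ℝ) + 1))) ⊆
      ⋃ i : {i // i ≠ j}, {y | ⟪e y, n i⟫ = h i - h j * ⟪n j, n i⟫} := by
    rintro y ⟨hy, hny⟩
    by_contra hcon
    simp only [mem_iUnion, mem_ofPred_eq, Subtype.exists, not_exists] at hcon
    refine hny ?_
    have hev : ∀ᶠ m : ℕ in atTop, ∀ i, i ≠ j →
        ⟪e y, n i⟫ ≤ h i - h j * ⟪n j, n i⟫ + -(1 / ((m : ℝ) + 1)) := by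
      rw [eventually_all]
      intro i
      by_cases hi : i = j
      · simp [hi]
      have hlt : ⟪e y, n i⟫ < h i - h j * ⟪n j, n i⟫ + -0 := by
        have := hy i hi
        rw [add_zero] at this
        rw [neg_zero, add_zero]
        exact lt_of_le_of_ne this (hcon i hi)
      have hlim : Tendsto (fun m : ℕ => h i - h j * ⟪n j, n i⟫ + -(1 / ((m : ℝ) + 1))) atTop
          (𝓝 (h i - h j * ⟪n j, n i⟫ + -0)) :=
        tendsto_const_nhds.add tendsto_one_div_add_atTop_nhds_zero_nat.neg
      filter_upwards [hlim.eventually_const_lt hlt] with m hm _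
      exact hm.le
    obtain ⟨m, hm⟩ := hev.exists
    exact mem_iUnion.2 ⟨m, hm⟩
  refine measure_mono_null hsub (measure_iUnion_null fun ⟨i, hi⟩ => ?_)
  rcases exists_inner_ne_zero_or_eq hunit hinj hsurj hi with hex | hneg
  · exact volume_inner_eq_const e hex _
  · obtain ⟨x, hx⟩ := hinner
    have hxi := hx i
    have hxj := hx j
    rw [hneg, inner_neg_right] at hxi
    convert measure_empty (μ := (volume : Measure (EuclideanSpace ℝ (Fin k))))
    refine eq_empty_of_forall_notMem fun y hy => ?_
    have hy' : ⟪e y, n i⟫ = h i - h j * ⟪n j, n i⟫ := hy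
    rw [hneg, inner_neg_right, inner_neg_right, he, real_inner_self_eq_norm_sq, hunit] at hy'
    linarith

lemma tendsto_slope_mul_pow (c V : ℝ) (N : ℕ) :
    Tendsto (fun t : ℝ => t⁻¹ * (V * (1 + t * c) ^ N - V)) (𝓝[≠] 0) (𝓝 (N * V * c)) := by
  have hd : HasDerivAt (fun t : ℝ => V * (1 + t * c) ^ N) (N * V * c) 0 := by
    have h1 : HasDerivAt (fun t : ℝ => 1 + t * c) c 0 := by
      simpa using ((hasDerivAt_id (0 : ℝ)).mul_const c).const_add 1
    refine ((h1.pow N).const_mul V).congr_deriv ?_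
    rw [zero_mul, add_zero, one_pow]
    ring
  simpa using hd.tendsto_slope_zero

variable [Fintype ι] [FiniteDimensional ℝ E] [MeasurableSpace E] [BorelSpace E]

/-- The first-order condition satisfied by a polyhedron that maximizes the volume relative to
`(∑ i, f i * h i) ^ N`: its facet volumes are proportional to `f`. -/
lemma volume_facetSlice_of_maximizing {f : ι → ℝ} {N : ℕ}
    (hc : ∀ h, IsCompact (polyhedron n h)) (hunit : ∀ i, ‖n i‖ = 1)
    (hinj : Function.Injective n) (hinner : ∃ x, ∀ i, ⟪x, n i⟫ < h i) (hL : ∑ i, f i * h i = 1)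
    (hmax : ∀ h' : ι → ℝ, 0 < ∑ i, f i * h' i → volume.real (polyhedron n h') ≤
        volume.real (polyhedron n h) * (∑ i, f i * h' i) ^ N)
    (he : ∀ y, ⟪e y, n j⟫ = 0) (hsurj : ∀ x, ⟪x, n j⟫ = 0 → ∃ y, e y = x)
    (hmp : MeasurePreserving (fun p : ℝ × EuclideanSpace ℝ (Fin k) => p.1 • n j + e p.2)) :
    volume.real (facetSlice n h j e 0) = N * volume.real (polyhedron n h) * f j := by
  classical
  set V := volume.real (polyhedron n h)
  have hfin : ∀ t, volume (facetSlice n h j e t) ≠ ⊤ := fun t =>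
    (isCompact_facetSlice hc (hunit j) he t).measure_lt_top.ne
  have hupd : ∀ t, ∑ i, f i * Function.update h j (h j + t) i = 1 + t * f j := by
    intro t
    rw [← hL, ← Finset.add_sum_erase _ _ (Finset.mem_univ j),
      ← Finset.add_sum_erase _ (fun i => f i * h i) (Finset.mem_univ j)]
    rw [Finset.sum_congr rfl fun i hi => by
      rw [Function.update_of_ne (Finset.ne_of_mem_erase hi)]]
    simp only [Function.update_self]
    ring
  have hpert : ∀ᶠ t in 𝓝 (0 : ℝ),
      volume.real (polyhedron n (Function.update h j (h j + t))) ≤ V * (1 + t * f j) ^ N := by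
    have hcont : Tendsto (fun t : ℝ => 1 + t * f j) (𝓝 0) (𝓝 (1 + 0 * f j)) :=
      Continuous.tendsto (by fun_prop) 0
    filter_upwards [hcont.eventually_const_lt (by simp : (0 : ℝ) < 1 + 0 * f j)] with t ht
    have := hmax (Function.update h j (h j + t)) (by rwa [hupd])
    rwa [hupd] at this
  have hpos : ∀ m : ℕ, (0 : ℝ) < 1 / ((m : ℝ) + 1) := fun m => by positivity
  have hseq : Tendsto (fun m : ℕ => 1 / ((m : ℝ) + 1)) atTop (𝓝[≠] 0) :=
    tendsto_nhdsWithin_iff.2 ⟨tendsto_one_div_add_atTop_nhds_zero_nat,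
      Eventually.of_forall fun m => (hpos m).ne'⟩
  have hseqn : Tendsto (fun m : ℕ => -(1 / ((m : ℝ) + 1))) atTop (𝓝[≠] 0) :=
    tendsto_nhdsWithin_iff.2 ⟨by
      rw [← neg_zero]
      exact tendsto_one_div_add_atTop_nhds_zero_nat.neg,
      Eventually.of_forall fun m => (neg_lt_zero.2 (hpos m)).ne⟩
  apply le_antisymm
  · have hmono : Monotone fun m : ℕ => facetSlice n h j e (-(1 / ((m : ℝ) + 1))) := by
      intro a b hab
      refine facetSlice_mono (neg_le_neg ?_)
      gcongr
    have hvol : volume (⋃ m : ℕ, facetSlice n h j e (-(1 / ((m : ℝ) + 1)))) =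
        volume (facetSlice n h j e 0) := by
      refine le_antisymm (measure_mono (iUnion_subset fun m =>
        facetSlice_mono (neg_nonpos.2 (hpos m).le))) ?_
      exact measure_mono_ae (ae_le_set.2
        (volume_facetSlice_zero_sdiff hunit hinj hinner he hsurj))
    have hlim := tendsto_measure_iUnion_atTop (μ := volume) hmono
    rw [hvol] at hlim
    refine le_of_tendsto_of_tendsto ((ENNReal.tendsto_toReal (hfin 0)).comp hlim)
      ((tendsto_slope_mul_pow (f j) V N).comp hseq) ?_
    filter_upwards [(hseq.mono_right nhdsWithin_le_nhds).eventually hpert] with m hm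
    have h1 := mul_volume_facetSlice_le (h := h) hc hunit he hmp (hpos m)
    show volume.real _ ≤ _⁻¹ * _
    rw [inv_mul_eq_div, le_div_iff₀' (hpos m)]
    linarith
  · have hanti : Antitone fun m : ℕ => facetSlice n h j e (1 / ((m : ℝ) + 1)) := by
      intro a b hab
      refine facetSlice_mono ?_
      gcongr
    have hlim := tendsto_measure_iInter_atTop (μ := volume)
      (fun m : ℕ => (isCompact_facetSlice hc (hunit j) he
        (1 / ((m : ℝ) + 1))).measurableSet.nullMeasurableSet) hanti ⟨0, hfin _⟩
    rw [← facetSlice_zero_eq_iInter] at hlim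
    refine le_of_tendsto_of_tendsto ((tendsto_slope_mul_pow (f j) V N).comp hseqn)
      ((ENNReal.tendsto_toReal (hfin 0)).comp hlim) ?_
    filter_upwards [(hseqn.mono_right nhdsWithin_le_nhds).eventually hpert] with m hm
    have h1 := sub_le_mul_volume_facetSlice (h := h) hc hunit he hmp (hpos m)
    rw [sub_eq_add_neg (h j)] at h1
    show _⁻¹ * _ ≤ volume.real _
    rw [inv_neg, neg_mul_comm, inv_mul_eq_div, div_le_iff₀' (hpos m)]
    linarith

end FacetVolume

section Polytope

variable {ι E : Type*} [NormedAddCommGroup E] [InnerProductSpace ℝ E] {n : ι → E} {h : ι → ℝ}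

/-- A point of a polyhedron can be moved a little in a direction that does not violate the
constraints active at the point. -/
lemma exists_add_smul_mem_polyhedron [Finite ι] {x v : E} (hx : x ∈ polyhedron n h)
    (hv : ∀ i, ⟪x, n i⟫ = h i → ⟪v, n i⟫ ≤ 0) :
    ∃ ε : ℝ, 0 < ε ∧ x + ε • v ∈ polyhedron n h := by
  have hev : ∀ᶠ ε : ℝ in 𝓝[>] 0, ∀ i, ⟪x + ε • v, n i⟫ ≤ h i := by
    rw [eventually_all]
    intro i
    rcases (hx i).lt_or_eq with hlt | heq
    · have hcont : Tendsto (fun ε : ℝ => ⟪x + ε • v, n i⟫) (𝓝[>] 0) (𝓝 ⟪x + (0 : ℝ) • v, n i⟫) :=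
        (Continuous.tendsto (by fun_prop) 0).mono_left nhdsWithin_le_nhds
      exact hcont.eventually_le_const (by simpa using hlt)
    · filter_upwards [self_mem_nhdsWithin] with ε hε
      rw [inner_add_left, real_inner_smul_left, heq]
      have := mul_nonpos_of_nonneg_of_nonpos (le_of_lt hε) (hv i heq)
      linarith
  obtain ⟨ε, hε, hmem⟩ := (hev.and self_mem_nhdsWithin).exists
  exact ⟨ε, hmem, hε⟩

lemma finite_extremePoints_polyhedron [Finite ι] : ((polyhedron n h).extremePoints ℝ).Finite := by
  refine Set.Finite.of_finite_image (f := fun x => {i | ⟪x, n i⟫ = h i}) (toFinite _) ?_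
  intro x hx y hy hxy
  have hact : ∀ i, ⟪x, n i⟫ = h i → ⟪y, n i⟫ = h i := fun i hi =>
    (Set.ext_iff.1 hxy i).1 hi
  obtain ⟨ε, hε, hmem⟩ := exists_add_smul_mem_polyhedron (v := x - y) hx.1 fun i hi => by
    rw [inner_sub_left, hi, hact i hi, sub_self]
  refine (hx.2 hy.1 hmem ⟨ε / (1 + ε), 1 / (1 + ε), by positivity, by positivity, ?_, ?_⟩).symm
  · field_simp
    ring
  · match_scalars <;> field_simp
    ring

lemma exists_finset_polyhedron_eq_convexHull [Finite ι] (hc : IsCompact (polyhedron n h)) :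
    ∃ S : Finset E, polyhedron n h = convexHull ℝ (S : Set E) := by
  have hfin : ((polyhedron n h).extremePoints ℝ).Finite := finite_extremePoints_polyhedron
  refine ⟨hfin.toFinset, ?_⟩
  rw [hfin.coe_toFinset, ← (hfin.isClosed_convexHull ℝ).closure_eq,
    closure_convexHull_extremePoints hc (convex_polyhedron n h)]

lemma interior_polyhedron_nonempty [FiniteDimensional ℝ E] [MeasurableSpace E] [BorelSpace E]
    (hvol : 0 < volume.real (polyhedron n h)) : (interior (polyhedron n h)).Nonempty := by
  by_contra hemp
  rw [not_nonempty_iff_eq_empty] at hemp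
  have hfr := (convex_polyhedron n h).addHaar_frontier volume
  rw [(isClosed_polyhedron n h).frontier_eq, hemp, sdiff_empty] at hfr
  rw [measureReal_def, hfr] at hvol
  exact hvol.false

lemma inner_lt_of_mem_interior (hunit : ∀ i, ‖n i‖ = 1) {x : E}
    (hx : x ∈ interior (polyhedron n h)) (i : ι) : ⟪x, n i⟫ < h i := by
  have hcont : Tendsto (fun ε : ℝ => x + ε • n i) (𝓝[>] 0) (𝓝 (x + (0 : ℝ) • n i)) :=
    (Continuous.tendsto (by fun_prop) 0).mono_left nhdsWithin_le_nhds
  rw [zero_smul, add_zero] at hcont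
  obtain ⟨ε, hmem, hε⟩ :=
    ((hcont.eventually (mem_interior_iff_mem_nhds.1 hx)).and self_mem_nhdsWithin).exists
  have h1 : ⟪x + ε • n i, n i⟫ ≤ h i := hmem i
  rw [inner_add_left, real_inner_smul_left, real_inner_self_eq_norm_sq, hunit] at h1
  have h2 : 0 < ε := hε
  linarith

end Polytope

section Faces

variable {ι : Type*} {d k : ℕ} {n : ι → EuclideanSpace ℝ (Fin d)} {h : ι → ℝ} {j : ι}
  {e : EuclideanSpace ℝ (Fin k) →ₗᵢ[ℝ] EuclideanSpace ℝ (Fin d)}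

lemma face_polyhedron_eq_image (hj : ‖n j‖ = 1) (he : ∀ y, ⟪e y, n j⟫ = 0)
    (hsurj : ∀ x, ⟪x, n j⟫ = 0 → ∃ y, e y = x) (hne : (facetSlice n h j e 0).Nonempty) :
    face (polyhedron n h) (n j) = (fun y => h j • n j + e y) '' facetSlice n h j e 0 := by
  have hval : ∀ y, ⟪h j • n j + e y, n j⟫ = h j := fun y => by
    rw [inner_add_left, he, real_inner_smul_left, real_inner_self_eq_norm_sq, hj]
    ring
  refine Subset.antisymm ?_ ?_
  · rintro x ⟨hxP, hx⟩
    obtain ⟨y₀, hy₀⟩ := hne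
    have hxj : ⟪x, n j⟫ = h j := by
      refine le_antisymm (hxP j) ?_
      have := hx _ ((mem_facetSlice_zero hj he y₀).1 hy₀)
      rwa [hval] at this
    obtain ⟨y, hy⟩ := hsurj (x - h j • n j) (by
      rw [inner_sub_left, hxj, real_inner_smul_left, real_inner_self_eq_norm_sq, hj]
      ring)
    have hxy : h j • n j + e y = x := by rw [hy, add_sub_cancel]
    exact ⟨y, (mem_facetSlice_zero hj he y).2 (by rwa [hxy]), hxy⟩
  · rintro _ ⟨y, hy, rfl⟩
    refine ⟨(mem_facetSlice_zero hj he y).1 hy, fun z hz => ?_⟩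
    rw [hval]
    exact hz j

lemma facetSlice_smul {r : ℝ} (hr : 0 < r) :
    facetSlice n (r • h) j e 0 = r • facetSlice n h j e 0 := by
  ext y
  rw [mem_smul_set_iff_inv_smul_mem₀ hr.ne']
  refine forall_congr' fun i => forall_congr' fun _ => ?_
  rw [map_smul, real_inner_smul_left, inv_mul_le_iff₀ hr]
  simp only [Pi.smul_apply, smul_eq_mul]
  ring_nf

lemma faceDim_image (a : EuclideanSpace ℝ (Fin d)) {K : Set (EuclideanSpace ℝ (Fin k))}
    (hK : volume K ≠ 0) : faceDim ((fun y => a + e y) '' K) = k := by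
  have htop : affineSpan ℝ K = ⊤ := by
    by_contra hne
    exact hK (measure_mono_null (subset_affineSpan ℝ K)
      (Measure.addHaar_affineSubspace volume _ hne))
  let φ : EuclideanSpace ℝ (Fin k) →ᵃ[ℝ] EuclideanSpace ℝ (Fin d) :=
    (AffineEquiv.constVAdd ℝ _ a).toAffineMap.comp e.toLinearMap.toAffineMap
  have hφ : (fun y => a + e y) = φ := rfl
  have hlin : φ.linear = e.toLinearMap := by
    ext y
    simp [φ]
  rw [faceDim, hφ, ← AffineSubspace.map_span, htop, AffineSubspace.map_direction,
    AffineSubspace.direction_top, hlin, Submodule.map_top,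
    LinearMap.finrank_range_of_inj e.injective,
    finrank_euclideanSpace_fin]

lemma direction_affineSpan_le_orthogonal {F : Set (EuclideanSpace ℝ (Fin d))}
    {w : EuclideanSpace ℝ (Fin d)} {c : ℝ} (hF : ∀ x ∈ F, ⟪x, w⟫ = c) :
    (affineSpan ℝ F).direction ≤ (ℝ ∙ w)ᗮ := by
  rw [direction_affineSpan, vectorSpan_def, Submodule.span_le]
  rintro _ ⟨x, hx, y, hy, rfl⟩
  refine Submodule.mem_orthogonal_singleton_iff_inner_left.2 ?_
  show ⟪x - y, w⟫ = 0
  rw [inner_sub_left, hF x hx, hF y hy, sub_self]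

/-- A face of a polyhedron lies in one of the bounding hyperplanes. -/
lemma exists_face_subset_hyperplane [Finite ι] [Nonempty ι] {ν : EuclideanSpace ℝ (Fin d)}
    (hν : ν ≠ 0) : ∃ i, ∀ x ∈ face (polyhedron n h) ν, ⟪x, n i⟫ = h i := by
  have := Fintype.ofFinite ι
  by_contra! hcon
  choose z hz hne using hcon
  have hcard : (0 : ℝ) < Fintype.card ι := by exact_mod_cast Fintype.card_pos
  set w : ℝ := (Fintype.card ι : ℝ)⁻¹ with hw
  have hw0 : 0 < w := inv_pos.2 hcard
  have hw1 : ∑ _i : ι, w = 1 := by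
    rw [Finset.sum_const, Finset.card_univ, nsmul_eq_mul, mul_inv_cancel₀ hcard.ne']
  set x := ∑ i, w • z i with hx
  have hxP : x ∈ polyhedron n h :=
    (convex_polyhedron n h).sum_mem (fun _ _ => hw0.le) hw1 fun i _ => (hz i).1
  have hmax : ∀ y ∈ polyhedron n h, ⟪y, ν⟫ ≤ ⟪x, ν⟫ := by
    intro y hy
    rw [hx, sum_inner]
    calc ⟪y, ν⟫ = ∑ _i : ι, w * ⟪y, ν⟫ := by rw [← Finset.sum_mul, hw1, one_mul]
      _ ≤ ∑ i, ⟪w • z i, ν⟫ := Finset.sum_le_sum fun i _ => by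
        rw [real_inner_smul_left]
        exact mul_le_mul_of_nonneg_left ((hz i).2 y hy) hw0.le
  have hstrict : ∀ i, ⟪x, n i⟫ < h i := by
    intro i
    rw [hx, sum_inner]
    calc ∑ l, ⟪w • z l, n i⟫ < ∑ _l : ι, w * h i := by
          refine Finset.sum_lt_sum (fun l _ => ?_) ⟨i, Finset.mem_univ i, ?_⟩
          · rw [real_inner_smul_left]
            exact mul_le_mul_of_nonneg_left ((hz l).1 i) hw0.le
          · rw [real_inner_smul_left]
            exact mul_lt_mul_of_pos_left (lt_of_le_of_ne ((hz i).1 i) (hne i)) hw0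
      _ = h i := by rw [← Finset.sum_mul, hw1, one_mul]
  obtain ⟨ε, hε, hmem⟩ := exists_add_smul_mem_polyhedron (v := ν) hxP
    fun i hi => absurd hi (hstrict i).ne
  have h1 := hmax _ hmem
  rw [inner_add_left, real_inner_smul_left] at h1
  have h2 : 0 < ε * ⟪ν, ν⟫ := mul_pos hε (real_inner_self_pos.2 hν)
  linarith

lemma exists_eq_of_faceDim_eq [Finite ι] [Nonempty ι] (hd : 2 ≤ d) (hunit : ∀ i, ‖n i‖ = 1)
    (hinner : ∃ x, ∀ i, ⟪x, n i⟫ < h i) {ν : EuclideanSpace ℝ (Fin d)} (hν : ‖ν‖ = 1)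
    (hdim : faceDim (face (polyhedron n h) ν) = d - 1) : ∃ i, ν = n i := by
  have hne0 : ∀ {w : EuclideanSpace ℝ (Fin d)}, ‖w‖ = 1 → w ≠ 0 := fun hw =>
    norm_ne_zero_iff.1 (by rw [hw]; exact one_ne_zero)
  have hfact : Fact (finrank ℝ (EuclideanSpace ℝ (Fin d)) = d - 1 + 1) :=
    ⟨by rw [finrank_euclideanSpace_fin]; omega⟩
  set F := face (polyhedron n h) ν with hF
  have hnonempty : F.Nonempty := by
    rw [nonempty_iff_ne_empty]
    intro hemp
    rw [hemp, faceDim, AffineSubspace.span_empty, AffineSubspace.direction_bot, finrank_bot] at hdim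
    omega
  obtain ⟨x, hx⟩ := hnonempty
  obtain ⟨i, hi⟩ := exists_face_subset_hyperplane (n := n) (h := h) (hne0 hν)
  have hdir : ∀ {w : EuclideanSpace ℝ (Fin d)} {c : ℝ}, ‖w‖ = 1 → (∀ x ∈ F, ⟪x, w⟫ = c) →
      (affineSpan ℝ F).direction = (ℝ ∙ w)ᗮ := fun hw hc =>
    Submodule.eq_of_le_of_finrank_eq (direction_affineSpan_le_orthogonal hc)
      (hdim.trans (Submodule.finrank_orthogonal_span_singleton (hne0 hw)).symm)
  have horth : (ℝ ∙ ν)ᗮ = (ℝ ∙ n i)ᗮ := by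
    rw [← hdir (hunit i) hi]
    exact (hdir hν fun y hy => le_antisymm (hx.2 y hy.1) (hy.2 x hx.1)).symm
  have hmem : ν ∈ ℝ ∙ n i := by
    rw [← Submodule.orthogonal_orthogonal (ℝ ∙ n i), ← horth, Submodule.orthogonal_orthogonal]
    exact Submodule.mem_span_singleton_self ν
  obtain ⟨c, hc⟩ := Submodule.mem_span_singleton.1 hmem
  have habs : |c| = 1 := by
    have := congrArg norm hc
    rwa [norm_smul, hunit, hν, mul_one, Real.norm_eq_abs] at this
  refine ⟨i, ?_⟩
  rcases eq_or_eq_neg_of_abs_eq habs with rfl | rfl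
  · rw [← hc, one_smul]
  · obtain ⟨x₀, hx₀⟩ := hinner
    rw [neg_one_smul] at hc
    have h1 := hx.2 x₀ fun l => (hx₀ l).le
    rw [← hc, inner_neg_right, inner_neg_right, hi x hx] at h1
    linarith [hx₀ i]

lemma exists_hausdorffMeasure_eq_mul_volume (k : ℕ) :
    ∃ c : ℝ, 0 < c ∧ ∀ s : Set (EuclideanSpace ℝ (Fin k)),
      (μH[(k : ℝ)] s).toReal = c * volume.real s := by
  have hhaar : (μH[(k : ℝ)] : Measure (EuclideanSpace ℝ (Fin k))).IsAddHaarMeasure := by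
    simpa using isAddHaarMeasure_hausdorffMeasure (E := EuclideanSpace ℝ (Fin k))
  refine ⟨Measure.addHaarScalarFactor μH[(k : ℝ)] (volume : Measure (EuclideanSpace ℝ (Fin k))),
    Measure.addHaarScalarFactor_pos_of_isAddHaarMeasure _ _, fun s => ?_⟩
  conv_lhs => rw [Measure.isAddLeftInvariant_eq_smul μH[(k : ℝ)]
    (volume : Measure (EuclideanSpace ℝ (Fin k)))]
  rw [Measure.smul_apply, ENNReal.smul_def, smul_eq_mul, ENNReal.toReal_mul,
    ENNReal.coe_toReal, measureReal_def]

end Faces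

end MinkowskiExistence

open MinkowskiExistence

/-- **Minkowski existence theorem.** Given unit vectors `n 1, …, n m` not contained in a
closed half-space bounded by a hyperplane through the origin, and positive reals
`f 1, …, f m` with `∑ j, f j • n j = 0`, there is a convex polytope in `ℝ^d` whose
`(d-1)`-dimensional faces have exactly the `n j` as unit outward normals, the face with
normal `n j` having `(d-1)`-volume `f j`. -/
theorem minkowski_existence (d m : ℕ) (hd : 2 ≤ d)
    (n : Fin m → EuclideanSpace ℝ (Fin d)) (f : Fin m → ℝ)
    (hunit : ∀ j, ‖n j‖ = 1) (hinj : Function.Injective n)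
    (hhalf : ¬ ∃ u : EuclideanSpace ℝ (Fin d), u ≠ 0 ∧ ∀ j, inner (𝕜 := ℝ) (n j) u ≤ 0)
    (hpos : ∀ j, 0 < f j) (hsum : ∑ j, f j • n j = 0) :
    ∃ P : Set (EuclideanSpace ℝ (Fin d)), IsConvexPolytope P ∧
      (∀ ν : EuclideanSpace ℝ (Fin d), ‖ν‖ = 1 →
        (faceDim (face P ν) = d - 1 ↔ ∃ j, ν = n j)) ∧
      (∀ j, (μH[((d : ℝ) - 1)] (face P (n j))).toReal = f j) := by
  obtain ⟨k, rfl⟩ : ∃ k, d = k + 1 := ⟨d - 1, by omega⟩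
  have hk : k ≠ 0 := by omega
  have hfinrank : Module.finrank ℝ (EuclideanSpace ℝ (Fin (k + 1))) = k + 1 :=
    finrank_euclideanSpace_fin
  have hne : Nonempty (Fin m) := by
    by_contra hemp
    rw [not_nonempty_iff] at hemp
    have : Nontrivial (EuclideanSpace ℝ (Fin (k + 1))) :=
      Module.nontrivial_of_finrank_pos (R := ℝ) (by omega)
    obtain ⟨u, hu⟩ := exists_ne (0 : EuclideanSpace ℝ (Fin (k + 1)))
    exact hhalf ⟨u, hu, fun j => hemp.elim j⟩
  have hspan : ∀ x, (∀ j, inner ℝ x (n j) = 0) → x = 0 := by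
    intro x hx
    by_contra hx0
    exact hhalf ⟨x, hx0, fun j => by rw [real_inner_comm, hx]⟩
  have hcomp := isCompact_polyhedron hspan hpos hsum
  obtain ⟨h, hL, hV, hmax⟩ := exists_polyhedron_maximizing_volume hunit hpos hsum hcomp
  have hinner : ∃ x, ∀ j, inner ℝ x (n j) < h j := by
    obtain ⟨x, hx⟩ := interior_polyhedron_nonempty hV
    exact ⟨x, inner_lt_of_mem_interior hunit hx⟩
  choose e he hsurj hmp using fun j => exists_hyperplane_coordinates hfinrank (hunit j)
  have harea := fun j =>
    volume_facetSlice_of_maximizing hcomp hunit hinj hinner hL hmax (he j) (hsurj j) (hmp j)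
  rw [hfinrank] at harea
  obtain ⟨c, hc, hμ⟩ := exists_hausdorffMeasure_eq_mul_volume k
  set V := volume.real (polyhedron n h)
  have ha : 0 < c * ((k + 1 : ℕ) * V) := by positivity
  obtain ⟨r, hr, hrk⟩ : ∃ r : ℝ, 0 < r ∧ r ^ k = (c * ((k + 1 : ℕ) * V))⁻¹ :=
    ⟨_, Real.rpow_pos_of_pos (inv_pos.2 ha) _, Real.rpow_inv_natCast_pow (inv_pos.2 ha).le hk⟩
  have hslice : ∀ j, volume.real (facetSlice n (r • h) j (e j) 0) = c⁻¹ * f j := by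
    intro j
    rw [facetSlice_smul hr, measureReal_def, Measure.addHaar_smul, finrank_euclideanSpace_fin,
      ENNReal.toReal_mul, ENNReal.toReal_ofReal (abs_nonneg _), abs_of_pos (by positivity),
      ← measureReal_def, harea, hrk]
    field_simp
  have hslice0 : ∀ j, volume (facetSlice n (r • h) j (e j) 0) ≠ 0 := by
    intro j h0
    have := hslice j
    rw [measureReal_def, h0, ENNReal.toReal_zero] at this
    exact (mul_pos (inv_pos.2 hc) (hpos j)).ne this
  have hface := fun j => face_polyhedron_eq_image (hunit j) (he j) (hsurj j)
    (nonempty_of_measure_ne_zero (hslice0 j))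
  have hV' : 0 < volume.real (polyhedron n (r • h)) := by
    rw [polyhedron_smul _ _ hr, measureReal_def, Measure.addHaar_smul, ENNReal.toReal_mul]
    refine mul_pos ?_ hV
    rw [ENNReal.toReal_ofReal (abs_nonneg _)]
    positivity
  have hinterior := interior_polyhedron_nonempty hV'
  refine ⟨polyhedron n (r • h),
    ⟨exists_finset_polyhedron_eq_convexHull (hcomp _), hinterior⟩, fun ν hν => ⟨fun hdim => ?_, ?_⟩,
    fun j => ?_⟩
  · obtain ⟨x, hx⟩ := hinterior
    exact exists_eq_of_faceDim_eq hd hunit ⟨x, inner_lt_of_mem_interior hunit hx⟩ hν hdim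
  · rintro ⟨j, rfl⟩
    rw [hface, faceDim_image _ (hslice0 j), Nat.add_sub_cancel]
  · have hiso : Isometry fun y => (r • h) j • n j + e j y :=
      (IsometryEquiv.addLeft ((r • h) j • n j)).isometry.comp (e j).isometry
    have hdim : ((k + 1 : ℕ) : ℝ) - 1 = k := by push_cast; ring
    rw [hface, hdim, hiso.hausdorffMeasure_image (Or.inl k.cast_nonneg), hμ, hslice,
      mul_inv_cancel_left₀ hc.ne']
end
end
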